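/- arXiv:2104.03860 — 8 statements merged into one kernel-verified Lean document; each statement's English description precedes it below -/
import Mathlib

section
/- Let d_x ≤ d_v be positive integers, let P be a real d_x×d_v matrix with I − P Pᵀ positive semidefinite, let B be a positive semidefinite real d_v×d_v matrix, and let λ > 0. Then (B + λI)⁻¹ − Pᵀ (P B Pᵀ + λI)⁻¹ P is positive semidefinite. (Here both B + λI and P B Pᵀ + λI are positive definite, hence invertible.) -/
open Matrix

/-- If `A` and `D` are positive definite and `P * A * Pᵀ ≤ D` in the Loewner order, then
`Pᵀ * D⁻¹ * P ≤ A⁻¹`: both are Schur complements of the block matrix `[A⁻¹, Pᵀ; P, D]`. -/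
theorem posSemidef_inv_sub_of_posSemidef_sub {m n : Type*} [Fintype m] [Fintype n]
    [DecidableEq m] [DecidableEq n] (P : Matrix m n ℝ) {A : Matrix n n ℝ} {D : Matrix m m ℝ}
    (hA : A.PosDef) (hD : D.PosDef) (h : (D - P * A * Pᵀ).PosSemidef) :
    (A⁻¹ - Pᵀ * D⁻¹ * P).PosSemidef := by
  let _ := hA.inv.isUnit.invertible
  let _ := hD.isUnit.invertible
  have hblock : (fromBlocks A⁻¹ Pᵀ Pᵀᴴ D).PosSemidef := by
    rw [PosDef.fromBlocks₁₁ Pᵀ D hA.inv,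
      nonsing_inv_nonsing_inv A ((isUnit_iff_isUnit_det A).1 hA.isUnit)]
    simpa using h
  simpa using (PosDef.fromBlocks₂₂ A⁻¹ Pᵀ hD).1 hblock

/-- key matrix inequality of Lemma 2 of the paper.
For `P : d_x × d_v` with `I - P * Pᵀ ⪰ 0`, `B ⪰ 0` and `λ > 0`,
`(B + λI)⁻¹ - Pᵀ (P B Pᵀ + λI)⁻¹ P ⪰ 0`. -/
theorem ridge_design_inv_sub_psd
    (dx dv : ℕ) (hdx : 0 < dx) (hdv : 0 < dv) (hle : dx ≤ dv)
    (P : Matrix (Fin dx) (Fin dv) ℝ)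
    (hP : ((1 : Matrix (Fin dx) (Fin dx) ℝ) - P * Pᵀ).PosSemidef)
    (B : Matrix (Fin dv) (Fin dv) ℝ) (hB : B.PosSemidef)
    (lam : ℝ) (hlam : 0 < lam) :
    ((B + lam • (1 : Matrix (Fin dv) (Fin dv) ℝ))⁻¹
      - Pᵀ * (P * B * Pᵀ + lam • (1 : Matrix (Fin dx) (Fin dx) ℝ))⁻¹ * P).PosSemidef := by
  have hA : (B + lam • (1 : Matrix (Fin dv) (Fin dv) ℝ)).PosDef :=
    Matrix.PosDef.posSemidef_add hB (Matrix.PosDef.one.smul hlam)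
  have hPB : (P * B * Pᵀ).PosSemidef := by
    simpa using hB.mul_mul_conjTranspose_same P
  have hD : (P * B * Pᵀ + lam • (1 : Matrix (Fin dx) (Fin dx) ℝ)).PosDef :=
    Matrix.PosDef.posSemidef_add hPB (Matrix.PosDef.one.smul hlam)
  exact posSemidef_inv_sub_of_posSemidef_sub P hA hD <| by
    convert hP.smul hlam.le using 1
    simp only [Matrix.mul_add, Matrix.add_mul, Matrix.mul_smul, Matrix.smul_mul,
      Matrix.mul_one, smul_sub]
    abel
end

section
/- Let d_x ≤ d_v be positive integers, let P be a real d_x×d_v matrix with I − P Pᵀ positive semidefinite, let B be a positive semidefinite real d_v×d_v matrix, and let λ > 0. Then the (d_v + d_x)×(d_v + d_x) block matrix M = [[(B + λI)⁻¹, Pᵀ], [P, P B Pᵀ + λI]] is positive semidefinite. -/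
open Matrix

/-- the block matrix `[[(B + λI)⁻¹, Pᵀ], [P, P B Pᵀ + λI]]` is
positive semidefinite, when `I - P Pᵀ ⪰ 0`, `B ⪰ 0` and `λ > 0`. -/
theorem block_matrix_psd
    (dx dv : ℕ) (hdx : 0 < dx) (hdv : 0 < dv) (hle : dx ≤ dv)
    (P : Matrix (Fin dx) (Fin dv) ℝ)
    (hP : ((1 : Matrix (Fin dx) (Fin dx) ℝ) - P * Pᵀ).PosSemidef)
    (B : Matrix (Fin dv) (Fin dv) ℝ) (hB : B.PosSemidef)
    (lam : ℝ) (hlam : 0 < lam) :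
    (Matrix.fromBlocks
        (B + lam • (1 : Matrix (Fin dv) (Fin dv) ℝ))⁻¹ Pᵀ
        P (P * B * Pᵀ + lam • (1 : Matrix (Fin dx) (Fin dx) ℝ))).PosSemidef := by
  have hA : (B + lam • (1 : Matrix (Fin dv) (Fin dv) ℝ)).PosDef :=
    PosDef.posSemidef_add hB (PosDef.one.smul hlam)
  have : Invertible (B + lam • (1 : Matrix (Fin dv) (Fin dv) ℝ))⁻¹ := hA.inv.isUnit.invertible
  have hSchur : P * B * Pᵀ + lam • (1 : Matrix (Fin dx) (Fin dx) ℝ)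
      - P * (B + lam • (1 : Matrix (Fin dv) (Fin dv) ℝ)) * Pᵀ = lam • (1 - P * Pᵀ) := by
    simp only [Matrix.mul_add, Matrix.add_mul, Matrix.mul_smul, Matrix.smul_mul, Matrix.mul_one,
      smul_sub]
    abel
  have key := PosDef.fromBlocks₁₁ Pᵀ
    (P * B * Pᵀ + lam • (1 : Matrix (Fin dx) (Fin dx) ℝ)) hA.inv
  rw [conjTranspose_eq_transpose_of_trivial, transpose_transpose,
    nonsing_inv_nonsing_inv _ ((isUnit_iff_isUnit_det _).mp hA.isUnit), hSchur] at key
  exact key.mpr (hP.smul hlam.le)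
end

section
/- Let d_x ≤ d_v be positive integers, let P be a real d_x×d_v matrix with I − P Pᵀ positive semidefinite, let B be a positive semidefinite real d_v×d_v matrix, and let λ > 0. Then for every vector v ∈ ℝ^{d_v}, writing x = P v, we have vᵀ (B + λI)⁻¹ v ≥ xᵀ (P B Pᵀ + λI)⁻¹ x; equivalently, ‖v‖_{A_v⁻¹} ≥ ‖x‖_{A_x⁻¹} where A_v = B + λI and A_x = P B Pᵀ + λI. -/
open Matrix

/-- If `A` and `M` are positive definite and `P A Pᵀ ≤ M` in the Loewner order, then the inverse
quadratic form of `M` at `P v` is at most that of `A` at `v`. -/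
theorem Matrix.PosDef.dotProduct_inv_mulVec_le {m n : Type*} [Fintype m] [Fintype n]
    [DecidableEq m] [DecidableEq n] {A : Matrix n n ℝ} {M : Matrix m m ℝ} (hA : A.PosDef)
    (hM : M.PosDef) {P : Matrix m n ℝ} (h : (M - P * A * Pᵀ).PosSemidef) (v : n → ℝ) :
    (P *ᵥ v) ⬝ᵥ (M⁻¹ *ᵥ (P *ᵥ v)) ≤ v ⬝ᵥ (A⁻¹ *ᵥ v) := by
  have hAu : A *ᵥ (A⁻¹ *ᵥ v) = v := by
    rw [mulVec_mulVec, mul_nonsing_inv _ ((isUnit_iff_isUnit_det _).mp hA.isUnit), one_mulVec]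
  have hMy : M *ᵥ (M⁻¹ *ᵥ (P *ᵥ v)) = P *ᵥ v := by
    rw [mulVec_mulVec, mul_nonsing_inv _ ((isUnit_iff_isUnit_det _).mp hM.isUnit), one_mulVec]
  set u := A⁻¹ *ᵥ v
  set y := M⁻¹ *ᵥ (P *ᵥ v)
  have hsq := hA.posSemidef.dotProduct_mulVec_nonneg (u - Pᵀ *ᵥ y)
  have hle := h.dotProduct_mulVec_nonneg y
  have hsymm : u ⬝ᵥ (A *ᵥ (Pᵀ *ᵥ y)) = v ⬝ᵥ (Pᵀ *ᵥ y) := by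
    have hAt : Aᵀ = A := by simpa using hA.isHermitian.eq
    rw [dotProduct_mulVec, ← mulVec_transpose, hAt, hAu]
  have hPy (w : n → ℝ) : (Pᵀ *ᵥ y) ⬝ᵥ w = y ⬝ᵥ (P *ᵥ w) := by
    rw [mulVec_transpose, dotProduct_mulVec]
  have hvy : v ⬝ᵥ (Pᵀ *ᵥ y) = y ⬝ᵥ (P *ᵥ v) := by rw [dotProduct_comm, hPy]
  simp only [star_trivial, mulVec_sub, sub_dotProduct, dotProduct_sub, hAu, hsymm, hvy, hPy] at hsq
  simp only [star_trivial, sub_mulVec, dotProduct_sub, hMy, ← mulVec_mulVec] at hle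
  rw [dotProduct_comm (P *ᵥ v) y, dotProduct_comm v u]
  linarith

/-- norm-comparison part of Lemma 2 of the paper. With
`A_v = B + λI` and `A_x = P B Pᵀ + λI`, for every `v` and `x = P v` we have
`vᵀ A_v⁻¹ v ≥ xᵀ A_x⁻¹ x`. -/
theorem quadratic_form_inv_comparison
    (dx dv : ℕ) (hdx : 0 < dx) (hdv : 0 < dv) (hle : dx ≤ dv)
    (P : Matrix (Fin dx) (Fin dv) ℝ)
    (hP : ((1 : Matrix (Fin dx) (Fin dx) ℝ) - P * Pᵀ).PosSemidef)
    (B : Matrix (Fin dv) (Fin dv) ℝ) (hB : B.PosSemidef)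
    (lam : ℝ) (hlam : 0 < lam) :
    ∀ v : Fin dv → ℝ,
      (P.mulVec v) ⬝ᵥ
          ((P * B * Pᵀ + lam • (1 : Matrix (Fin dx) (Fin dx) ℝ))⁻¹).mulVec (P.mulVec v)
        ≤ v ⬝ᵥ ((B + lam • (1 : Matrix (Fin dv) (Fin dv) ℝ))⁻¹).mulVec v := by
  have hlam_one (n : ℕ) : (lam • (1 : Matrix (Fin n) (Fin n) ℝ)).PosDef := PosDef.one.smul hlam
  have hPBP : (P * B * Pᵀ).PosSemidef := by simpa using hB.mul_mul_conjTranspose_same P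
  refine (PosDef.posSemidef_add hB (hlam_one dv)).dotProduct_inv_mulVec_le
    (PosDef.posSemidef_add hPBP (hlam_one dx)) ?_
  convert hP.smul hlam.le using 1
  simp [Matrix.mul_add, Matrix.add_mul, smul_sub]
end

section
/- (Lemma 2 of the paper.) Let d_x ≤ d_v be positive integers, P a real d_x×d_v matrix with I − P Pᵀ positive semidefinite, λ > 0, R ≥ 0, δ ∈ (0, 1], and t ≥ 0. Let v_1, …, v_t ∈ ℝ^{d_v} be the feature vectors of the arms pulled so far and set A_{v,t} = λI_{d_v} + Σ_{s=1}^{t} v_s v_sᵀ and A_{x,t} = λI_{d_x} + Σ_{s=1}^{t} (P v_s)(P v_s)ᵀ. Define α_{v,t} = R√(d_v · log((1 + t/λ)/δ)) + √λ and α_{x,t} = R√(d_x · log((1 + t/λ)/δ)) + √λ. Then for every vector v_a ∈ ℝ^{d_v}, with x_a = P v_a, the confidence widths satisfy CB_{v,t}(v_a) := α_{v,t} · ‖v_a‖_{A_{v,t}⁻¹} ≥ α_{x,t} · ‖x_a‖_{A_{x,t}⁻¹} =: CB_{x,t}(x_a). -/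
open Matrix

/-- If `P C Pᵀ ≤ B` in the Loewner order, then `Pᵀ B⁻¹ P ≤ C⁻¹`, as an inequality of
quadratic forms. -/
theorem Matrix.dotProduct_inv_mulVec_mulVec_le {m n : Type*} [Fintype m] [Fintype n]
    [DecidableEq m] [DecidableEq n] {B : Matrix m m ℝ} {C : Matrix n n ℝ} {P : Matrix m n ℝ}
    (hB : B.PosDef) (hC : C.PosDef) (h : (B - P * C * Pᵀ).PosSemidef) (x : n → ℝ) :
    (P *ᵥ x) ⬝ᵥ (B⁻¹ *ᵥ (P *ᵥ x)) ≤ x ⬝ᵥ (C⁻¹ *ᵥ x) := by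
  have hBu : IsUnit B.det := (Matrix.isUnit_iff_isUnit_det B).mp hB.isUnit
  have hCu : IsUnit C.det := (Matrix.isUnit_iff_isUnit_det C).mp hC.isUnit
  have hCt : Cᵀ = C := hC.isHermitian
  set w := B⁻¹ *ᵥ (P *ᵥ x) with hw
  set u := C⁻¹ *ᵥ x with hu
  have hBw : B *ᵥ w = P *ᵥ x := by
    rw [hw, mulVec_mulVec, mul_nonsing_inv _ hBu, one_mulVec]
  have hCx : C *ᵥ u = x := by
    rw [hu, mulVec_mulVec, mul_nonsing_inv _ hCu, one_mulVec]
  have adj : ∀ z : n → ℝ, (Pᵀ *ᵥ w) ⬝ᵥ z = w ⬝ᵥ (P *ᵥ z) := fun z => by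
    rw [mulVec_transpose, dotProduct_mulVec]
  have hsymm : u ⬝ᵥ (C *ᵥ (Pᵀ *ᵥ w)) = w ⬝ᵥ (P *ᵥ x) := by
    rw [dotProduct_mulVec, ← mulVec_transpose, hCt, hCx, dotProduct_comm, adj]
  have h₁ := h.dotProduct_mulVec_nonneg w
  have h₂ := hC.posSemidef.dotProduct_mulVec_nonneg (Pᵀ *ᵥ w - u)
  simp only [star_trivial, sub_mulVec, dotProduct_sub, hBw, ← mulVec_mulVec] at h₁
  simp only [star_trivial, mulVec_sub, sub_dotProduct, dotProduct_sub, hCx, hsymm] at h₂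
  rw [adj, adj] at h₂
  rw [dotProduct_comm (P *ᵥ x) w, dotProduct_comm x u]
  linarith

/-- A ridge-regularized Gram matrix is positive definite. -/
theorem Matrix.posDef_smul_one_add_sum_vecMulVec {ι n : Type*} [Fintype ι] [Fintype n]
    [DecidableEq n] {c : ℝ} (hc : 0 < c) (v : ι → n → ℝ) :
    (c • (1 : Matrix n n ℝ) + ∑ s, vecMulVec (v s) (v s)).PosDef :=
  (PosDef.one.smul hc).add_posSemidef <| posSemidef_sum _ fun s _ => by
    simpa using posSemidef_vecMulVec_self_star (v s)

/-- Lemma 2 of the paper. The system-side confidence width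
`CB_{v,t}(v_a) = α_{v,t} ‖v_a‖_{A_{v,t}⁻¹}` dominates the user-side width
`CB_{x,t}(x_a) = α_{x,t} ‖x_a‖_{A_{x,t}⁻¹}` with `x_a = P v_a`, where
`A_{v,t} = λI + Σ_s v_s v_sᵀ`, `A_{x,t} = λI + Σ_s (P v_s)(P v_s)ᵀ`,
`α_{v,t} = R √(d_v log((1 + t/λ)/δ)) + √λ` and
`α_{x,t} = R √(d_x log((1 + t/λ)/δ)) + √λ`. -/
theorem confidence_width_comparison
    (dx dv : ℕ) (hdx : 0 < dx) (hdv : 0 < dv) (hle : dx ≤ dv)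
    (P : Matrix (Fin dx) (Fin dv) ℝ)
    (hP : ((1 : Matrix (Fin dx) (Fin dx) ℝ) - P * Pᵀ).PosSemidef)
    (lam R δ : ℝ) (hlam : 0 < lam) (hR : 0 ≤ R) (hδ : 0 < δ) (hδ1 : δ ≤ 1)
    (t : ℕ) (v : Fin t → Fin dv → ℝ) :
    ∀ va : Fin dv → ℝ,
      (R * Real.sqrt (dx * Real.log ((1 + (t : ℝ) / lam) / δ)) + Real.sqrt lam) *
          Real.sqrt ((P.mulVec va) ⬝ᵥ
            ((lam • (1 : Matrix (Fin dx) (Fin dx) ℝ) +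
              ∑ s, Matrix.vecMulVec (P.mulVec (v s)) (P.mulVec (v s)))⁻¹).mulVec
              (P.mulVec va))
        ≤ (R * Real.sqrt (dv * Real.log ((1 + (t : ℝ) / lam) / δ)) + Real.sqrt lam) *
          Real.sqrt (va ⬝ᵥ
            ((lam • (1 : Matrix (Fin dv) (Fin dv) ℝ) +
              ∑ s, Matrix.vecMulVec (v s) (v s))⁻¹).mulVec va) := by
  intro va
  have hlog : 0 ≤ Real.log ((1 + (t : ℝ) / lam) / δ) := by
    apply Real.log_nonneg
    rw [one_le_div hδ]
    have : 0 ≤ (t : ℝ) / lam := by positivity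
    linarith
  gcongr
  refine dotProduct_inv_mulVec_mulVec_le (posDef_smul_one_add_sum_vecMulVec hlam _)
    (posDef_smul_one_add_sum_vecMulVec hlam v) ?_ va
  convert hP.smul hlam.le using 1
  simp only [Matrix.mul_add, Matrix.add_mul, Matrix.mul_sum, Matrix.sum_mul, mul_vecMulVec,
    vecMulVec_mul, vecMul_transpose, Matrix.mul_smul, Matrix.smul_mul, Matrix.mul_one, smul_sub]
  abel
end

section
/- (Core inequality of Lemma 3 of the paper.) Let 𝒜 be a finite nonempty set (of arms) and let r, r̂_x, r̂_v, CB_x, CB_v : 𝒜 → ℝ be functions such that for every a ∈ 𝒜: |r̂_x(a) − r(a)| ≤ CB_x(a), |r̂_v(a) − r(a)| ≤ CB_v(a), and 0 ≤ CB_x(a) ≤ CB_v(a). Let a_t ∈ 𝒜 be a maximizer of the map a ↦ r̂_v(a) + 2·CB_v(a) over 𝒜. Then for every g ∈ 𝒜, r̂_x(g) ≤ r̂_x(a_t) + 4·CB_v(a_t); in particular max_{a ∈ 𝒜} r̂_x(a) − r̂_x(a_t) ≤ 4·CB_v(a_t). -/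
/-- core inequality of Lemma 3 of the paper. On the confidence
event (estimates within confidence widths, user widths dominated by system
widths), if `a_t` maximizes `r̂_v(a) + 2 CB_v(a)` then every arm `g` satisfies
`r̂_x(g) ≤ r̂_x(a_t) + 4 CB_v(a_t)`; in particular
`max_a r̂_x(a) - r̂_x(a_t) ≤ 4 CB_v(a_t)`. -/
theorem compensation_core_inequality
    {𝒜 : Type*} [Fintype 𝒜] [Nonempty 𝒜]
    (r rx rv CBx CBv : 𝒜 → ℝ)
    (hx : ∀ a, |rx a - r a| ≤ CBx a)
    (hv : ∀ a, |rv a - r a| ≤ CBv a)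
    (hCB : ∀ a, 0 ≤ CBx a ∧ CBx a ≤ CBv a)
    (aₜ : 𝒜)
    (hmax : ∀ a, rv a + 2 * CBv a ≤ rv aₜ + 2 * CBv aₜ) :
    (∀ g, rx g ≤ rx aₜ + 4 * CBv aₜ) ∧
      Finset.univ.sup' Finset.univ_nonempty rx - rx aₜ ≤ 4 * CBv aₜ := by
  have key : ∀ g, rx g ≤ rx aₜ + 4 * CBv aₜ := fun g => by
    linarith [(abs_le.mp (hx g)).2, (abs_le.mp (hv g)).1, (hCB g).2, hmax g,
      (abs_le.mp (hv aₜ)).2, (abs_le.mp (hx aₜ)).1, (hCB aₜ).2]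
  exact ⟨key, sub_le_iff_le_add'.mpr (Finset.sup'_le _ _ fun g _ => key g)⟩
end

section
/- (Lemma 3 of the paper, restated as incentive correctness.) Let 𝒜 be a finite nonempty set and let r, r̂_x, r̂_v, CB_x, CB_v : 𝒜 → ℝ satisfy, for every a ∈ 𝒜: |r̂_x(a) − r(a)| ≤ CB_x(a), |r̂_v(a) − r(a)| ≤ CB_v(a), and 0 ≤ CB_x(a) ≤ CB_v(a). Let a_t ∈ 𝒜 maximize a ↦ r̂_v(a) + 2·CB_v(a), and define the compensation c : 𝒜 → ℝ by c(a_t) = 4·CB_v(a_t) and c(a) = 0 for a ≠ a_t. Then a_t maximizes a ↦ r̂_x(a) + c(a) over 𝒜, i.e., the myopic user who maximizes estimated reward plus compensation pulls arm a_t. -/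
/-- Lemma 3 of the paper as incentive correctness. With
compensation `c(a_t) = 4 CB_v(a_t)` and `c(a) = 0` for `a ≠ a_t`, the myopic
user maximizing `r̂_x(a) + c(a)` pulls arm `a_t`. -/
theorem incentive_correctness
    {𝒜 : Type*} [Fintype 𝒜] [Nonempty 𝒜]
    (r rx rv CBx CBv : 𝒜 → ℝ)
    (hx : ∀ a, |rx a - r a| ≤ CBx a)
    (hv : ∀ a, |rv a - r a| ≤ CBv a)
    (hCB : ∀ a, 0 ≤ CBx a ∧ CBx a ≤ CBv a)
    (aₜ : 𝒜)
    (hmax : ∀ a, rv a + 2 * CBv a ≤ rv aₜ + 2 * CBv aₜ)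
    (c : 𝒜 → ℝ)
    (hc_at : c aₜ = 4 * CBv aₜ)
    (hc_other : ∀ a, a ≠ aₜ → c a = 0) :
    ∀ a, rx a + c a ≤ rx aₜ + c aₜ := by
  intro a
  by_cases h : a = aₜ
  · rw [h]
  · rw [hc_at, hc_other a h]
    linarith [(hCB a).2, (hCB aₜ).2, hmax a, (abs_le.mp (hx a)).2, (abs_le.mp (hv a)).1,
      (abs_le.mp (hx aₜ)).1, (abs_le.mp (hv aₜ)).2]
end

section
/- (Elliptical potential bound.) Let d ≥ 1, λ ≥ 1, T ≥ 1, and let v_1, …, v_T ∈ ℝ^d with ‖v_t‖₂ ≤ 1 for all t. Define A_1 = λI_d and A_{t+1} = A_t + v_t v_tᵀ for 1 ≤ t ≤ T. Then Σ_{t=1}^{T} v_tᵀ A_t⁻¹ v_t ≤ 2·(log det(A_{T+1}) − d·log λ). -/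
open Matrix

namespace Matrix

/-- **Matrix determinant lemma** for a rank-one update. -/
theorem det_add_vecMulVec {n R : Type*} [Fintype n] [DecidableEq n] [CommRing R]
    {A : Matrix n n R} (hA : IsUnit A.det) (u v : n → R) :
    (A + vecMulVec u v).det = A.det * (1 + v ⬝ᵥ (A⁻¹ *ᵥ u)) := by
  rw [vecMulVec_eq Unit, det_add_replicateCol_mul_replicateRow hA, det_unique (n := Unit),
    Matrix.mul_assoc, ← replicateCol_mulVec]
  simp [mul_apply, dotProduct]

theorem PosSemidef.posDef_of_sub_one {n : Type*} [DecidableEq n] {A : Matrix n n ℝ}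
    (hA : (A - 1).PosSemidef) : A.PosDef := by
  simpa using PosDef.one.add_posSemidef hA

/-- If `1 ≤ A` in the Loewner order, then `A⁻¹ ≤ 1` on the unit ball. -/
theorem PosSemidef.dotProduct_inv_mulVec_le_one {n : Type*} [Fintype n] [DecidableEq n]
    {A : Matrix n n ℝ} (hA : (A - 1).PosSemidef) {v : n → ℝ} (hv : v ⬝ᵥ v ≤ 1) :
    v ⬝ᵥ (A⁻¹ *ᵥ v) ≤ 1 := by
  have hdet : IsUnit A.det := hA.posDef_of_sub_one.det_pos.ne'.isUnit
  have hAw : A *ᵥ (A⁻¹ *ᵥ v) = v := by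
    rw [mulVec_mulVec, mul_nonsing_inv _ hdet, one_mulVec]
  have hw := hA.dotProduct_mulVec_nonneg (A⁻¹ *ᵥ v)
  rw [star_trivial, sub_mulVec, one_mulVec, hAw, dotProduct_sub,
    dotProduct_comm (A⁻¹ *ᵥ v) v] at hw
  have hsq : 0 ≤ (v - A⁻¹ *ᵥ v) ⬝ᵥ (v - A⁻¹ *ᵥ v) :=
    Finset.sum_nonneg fun i _ => mul_self_nonneg _
  rw [sub_dotProduct, dotProduct_sub, dotProduct_sub, dotProduct_comm (A⁻¹ *ᵥ v) v] at hsq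
  linarith

/-- A rank-one update of `A ≥ 1` by `v` in the unit ball increases `log det A` by at least half of
`vᵀ A⁻¹ v`. -/
theorem PosSemidef.dotProduct_inv_mulVec_le_log_det {n : Type*} [Fintype n] [DecidableEq n]
    {A : Matrix n n ℝ} (hA : (A - 1).PosSemidef) {v : n → ℝ} (hv : v ⬝ᵥ v ≤ 1) :
    v ⬝ᵥ (A⁻¹ *ᵥ v) ≤ 2 * (Real.log (A + vecMulVec v v).det - Real.log A.det) := by
  have hpos := hA.posDef_of_sub_one
  have h0 : 0 ≤ v ⬝ᵥ (A⁻¹ *ᵥ v) := by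
    simpa using hpos.inv.posSemidef.dotProduct_mulVec_nonneg v
  have h1 := hA.dotProduct_inv_mulVec_le_one hv
  rw [det_add_vecMulVec hpos.det_pos.ne'.isUnit,
    Real.log_mul hpos.det_pos.ne' (by positivity), add_sub_cancel_left]
  generalize v ⬝ᵥ (A⁻¹ *ᵥ v) = x at h0 h1 ⊢
  have hlog := Real.le_log_one_add_of_nonneg h0
  have hx : x / 2 ≤ 2 * x / (x + 2) := by
    rw [div_le_div_iff₀ two_pos (by positivity)]
    nlinarith
  linarith

end Matrix

/-- elliptical potential bound (Lemma 11 of Abbasi-Yadkori et al.).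
With `A_1 = λI`, `A_{t+1} = A_t + v_t v_tᵀ`, `λ ≥ 1` and `‖v_t‖₂ ≤ 1`,
`Σ_{t=1}^T v_tᵀ A_t⁻¹ v_t ≤ 2 (log det A_{T+1} - d log λ)`. -/
theorem elliptical_potential_bound
    (d : ℕ) (hd : 1 ≤ d) (lam : ℝ) (hlam : 1 ≤ lam) (T : ℕ) (hT : 1 ≤ T)
    (v : ℕ → Fin d → ℝ)
    (hv : ∀ t, 1 ≤ t → t ≤ T → Real.sqrt (v t ⬝ᵥ v t) ≤ 1)
    (A : ℕ → Matrix (Fin d) (Fin d) ℝ)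
    (hA1 : A 1 = lam • (1 : Matrix (Fin d) (Fin d) ℝ))
    (hAs : ∀ t, 1 ≤ t → t ≤ T → A (t + 1) = A t + Matrix.vecMulVec (v t) (v t)) :
    ∑ t ∈ Finset.Icc 1 T, v t ⬝ᵥ ((A t)⁻¹).mulVec (v t)
      ≤ 2 * (Real.log (A (T + 1)).det - d * Real.log lam) := by
  have hpsd : ∀ t, 1 ≤ t → t ≤ T → (A t - 1).PosSemidef := by
    intro t ht
    induction t, ht using Nat.le_induction with
    | base =>
      intro _
      have h : A 1 - 1 = (lam - 1) • (1 : Matrix (Fin d) (Fin d) ℝ) := by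
        rw [hA1, sub_smul, one_smul]
      exact h ▸ PosSemidef.one.smul (sub_nonneg.2 hlam)
    | succ t ht ih =>
      intro htT
      rw [hAs t ht (by omega), add_sub_right_comm]
      exact (ih (by omega)).add (by simpa using posSemidef_vecMulVec_self_star (v t))
  have hstep : ∀ t ∈ Finset.Icc 1 T, v t ⬝ᵥ ((A t)⁻¹ *ᵥ v t)
      ≤ 2 * (Real.log (A (t + 1)).det - Real.log (A t).det) := by
    intro t ht
    obtain ⟨h1, hT'⟩ := Finset.mem_Icc.1 ht
    rw [hAs t h1 hT']
    exact (hpsd t h1 hT').dotProduct_inv_mulVec_le_log_det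
      (by simpa [Real.sqrt_le_iff] using hv t h1 hT')
  refine (Finset.sum_le_sum hstep).trans_eq ?_
  rw [← Finset.mul_sum, ← Finset.Ico_add_one_right_eq_Icc,
    Finset.sum_Ico_sub (fun t => Real.log (A t).det) (by omega), hA1]
  simp
end

section
/- (Deterministic core of Theorem 2 of the paper: cumulative regret on the confidence event, with corrected constants.) Let d ≥ 1, λ ≥ 1, T ≥ 1, θ* ∈ ℝ^d, and let α_1, …, α_T be a nonnegative nondecreasing sequence. For each round t = 1, …, T, let 𝒜_t be a finite nonempty set of arms with features v_a ∈ ℝ^d, ‖v_a‖₂ ≤ 1, let a_t ∈ 𝒜_t be the pulled arm, and set A_1 = λI_d, A_{t+1} = A_t + v_{a_t} v_{a_t}ᵀ. Suppose there exist vectors θ̂_t ∈ ℝ^d such that for all t and all a ∈ 𝒜_t, |⟨v_a, θ̂_t⟩ − ⟨v_a, θ*⟩| ≤ α_t·‖v_a‖_{A_t⁻¹}, and that a_t maximizes a ↦ ⟨v_a, θ̂_t⟩ + 2·α_t·‖v_a‖_{A_t⁻¹} over 𝒜_t. Then the cumulative regret satisfies Σ_{t=1}^{T} (max_{a ∈ 𝒜_t}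 ⟨v_a, θ*⟩ − ⟨v_{a_t}, θ*⟩) ≤ 3·α_T·√(2·T·d·log(1 + T/(λd))). -/
open Matrix

namespace Matrix

variable {n : Type*} [DecidableEq n]

lemma posDef_of_posSemidef_sub_smul_one {M : Matrix n n ℝ} {c : ℝ} (hc : 0 < c)
    (hM : (M - c • (1 : Matrix n n ℝ)).PosSemidef) : M.PosDef := by
  simpa using (PosDef.one.smul hc).add_posSemidef hM

variable [Fintype n]

/-- If `c • 1 ≤ M` in the Loewner order, then the quadratic form of `M⁻¹` is at most that of
`c⁻¹ • 1`. -/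
lemma mul_dotProduct_inv_mulVec_le {M : Matrix n n ℝ} {c : ℝ} (hc : 0 < c)
    (hM : (M - c • (1 : Matrix n n ℝ)).PosSemidef) (v : n → ℝ) :
    c * (v ⬝ᵥ M⁻¹ *ᵥ v) ≤ v ⬝ᵥ v := by
  have hdet : IsUnit M.det := (isUnit_iff_isUnit_det _).1
    (posDef_of_posSemidef_sub_smul_one hc hM).isUnit
  set u := M⁻¹ *ᵥ v with hu
  have hMu : M *ᵥ u = v := by rw [hu, mulVec_mulVec, mul_nonsing_inv _ hdet, one_mulVec]
  have hlow : c * (u ⬝ᵥ u) ≤ v ⬝ᵥ u := by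
    have h := hM.dotProduct_mulVec_nonneg u
    rw [star_trivial, sub_mulVec, hMu, smul_mulVec, one_mulVec, dotProduct_sub,
      dotProduct_smul, smul_eq_mul, dotProduct_comm u v] at h
    linarith
  have hsq : 0 ≤ (v - c • u) ⬝ᵥ (v - c • u) := by
    simpa using dotProduct_star_self_nonneg (v - c • u)
  simp only [sub_dotProduct, dotProduct_sub, smul_dotProduct, dotProduct_smul, smul_eq_mul,
    dotProduct_comm u v] at hsq
  nlinarith [mul_le_mul_of_nonneg_left hlow hc.le]

/-- The matrix determinant lemma for a symmetric rank-one update. -/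
lemma det_add_vecMulVec_self {M : Matrix n n ℝ} (hM : IsUnit M.det) (v : n → ℝ) :
    (M + vecMulVec v v).det = M.det * (1 + v ⬝ᵥ M⁻¹ *ᵥ v) := by
  rw [vecMulVec_eq Unit, det_add_replicateCol_mul_replicateRow hM]
  congr 1
  rw [det_unique, add_apply, one_apply_eq, Matrix.mul_assoc, ← replicateCol_mulVec]
  rfl

/-- The AM-GM inequality for the eigenvalues of a positive definite matrix, in logarithmic form. -/
lemma PosDef.log_det_le {M : Matrix n n ℝ} (hM : M.PosDef) {c : ℝ} (hc : 0 < c)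
    (htr : M.trace ≤ c * Fintype.card n) :
    Real.log M.det ≤ Fintype.card n * Real.log c := by
  have hpos := hM.eigenvalues_pos
  have hdet := hM.1.det_eq_prod_eigenvalues
  have htrace := hM.1.trace_eq_sum_eigenvalues
  simp only [RCLike.ofReal_real_eq_id, id_eq] at hdet htrace
  rw [hdet, Real.log_prod fun i _ => (hpos i).ne']
  have hle : ∀ i, Real.log (hM.1.eigenvalues i) ≤ Real.log c + (hM.1.eigenvalues i / c - 1) := by
    intro i
    have h := Real.log_le_sub_one_of_pos (div_pos (hpos i) hc)
    rw [Real.log_div (hpos i).ne' hc.ne'] at h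
    linarith
  refine (Finset.sum_le_sum fun i _ => hle i).trans ?_
  rw [Finset.sum_add_distrib, Finset.sum_sub_distrib, ← Finset.sum_div, ← htrace]
  have h : M.trace / c ≤ Fintype.card n := by rwa [div_le_iff₀' hc]
  simp only [Finset.sum_const, Finset.card_univ, nsmul_eq_mul, mul_one]
  linarith

end Matrix

lemma Real.le_two_mul_log_one_add {x : ℝ} (h0 : 0 ≤ x) (h1 : x ≤ 2) :
    x ≤ 2 * Real.log (1 + x) := by
  have h := Real.le_log_one_add_of_nonneg h0
  rw [div_le_iff₀ (by linarith)] at h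
  have hlog : 0 ≤ Real.log (1 + x) := Real.log_nonneg (by linarith)
  nlinarith

/-- The elliptical potential lemma. -/
lemma sum_dotProduct_inv_mulVec_le {n : Type*} [Fintype n] [DecidableEq n] [Nonempty n]
    {lam : ℝ} (hlam : 1 ≤ lam) (T : ℕ) (u : ℕ → n → ℝ) (A : ℕ → Matrix n n ℝ)
    (hu : ∀ t, 1 ≤ t → t ≤ T → u t ⬝ᵥ u t ≤ 1)
    (hA1 : A 1 = lam • (1 : Matrix n n ℝ))
    (hAs : ∀ t, 1 ≤ t → t ≤ T → A (t + 1) = A t + vecMulVec (u t) (u t)) :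
    (∀ t, 1 ≤ t → t ≤ T → 0 ≤ u t ⬝ᵥ (A t)⁻¹ *ᵥ u t) ∧
    ∑ t ∈ Finset.Icc 1 T, u t ⬝ᵥ (A t)⁻¹ *ᵥ u t
      ≤ 2 * Fintype.card n * Real.log (1 + T / (lam * Fintype.card n)) := by
  have hlam0 : 0 < lam := by linarith
  have hpsd : ∀ m ≤ T, (A (m + 1) - lam • (1 : Matrix n n ℝ)).PosSemidef := by
    intro m
    induction m with
    | zero => intro _; simpa [hA1] using PosSemidef.zero
    | succ m ih =>
      intro hm
      rw [hAs (m + 1) (by lia) hm, add_sub_right_comm]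
      simpa using (ih (by lia)).add (posSemidef_vecMulVec_self_star (u (m + 1)))
  have hpd : ∀ m ≤ T, (A (m + 1)).PosDef := fun m hm =>
    posDef_of_posSemidef_sub_smul_one hlam0 (hpsd m hm)
  have hnonneg : ∀ m ≤ T, ∀ w, 0 ≤ w ⬝ᵥ (A (m + 1))⁻¹ *ᵥ w := fun m hm w => by
    simpa using (hpd m hm).inv.posSemidef.dotProduct_mulVec_nonneg w
  have htrace : ∀ m ≤ T, (A (m + 1)).trace ≤ lam * Fintype.card n + m := by
    intro m
    induction m with
    | zero => intro _; simp [hA1, trace_smul]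
    | succ m ih =>
      intro hm
      rw [hAs (m + 1) (by lia) hm, trace_add, trace_vecMulVec]
      push_cast
      linarith [ih (by lia), hu (m + 1) (by lia) hm]
  have hsum : ∀ m ≤ T, ∑ t ∈ Finset.Icc 1 m, u t ⬝ᵥ (A t)⁻¹ *ᵥ u t
      ≤ 2 * (Real.log (A (m + 1)).det - Fintype.card n * Real.log lam) := by
    intro m
    induction m with
    | zero => intro _; simp [hA1]
    | succ m ih =>
      intro hm
      have hd := (hpd m (by lia)).det_pos
      have hx0 := hnonneg m (by lia) (u (m + 1))
      have hx := mul_dotProduct_inv_mulVec_le hlam0 (hpsd m (by lia)) (u (m + 1))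
      have hlog := Real.le_two_mul_log_one_add hx0
        (by nlinarith [hu (m + 1) (by lia) hm])
      rw [Finset.sum_Icc_succ_top (by lia), hAs (m + 1) (by lia) hm,
        det_add_vecMulVec_self hd.ne'.isUnit, Real.log_mul hd.ne' (by linarith)]
      linarith [ih (by lia)]
  refine ⟨fun t h1 hT => ?_, (hsum T le_rfl).trans ?_⟩
  · obtain ⟨m, rfl⟩ := Nat.exists_eq_add_of_le' h1
    exact hnonneg m (by lia) _
  · have hn : (0 : ℝ) < Fintype.card n := by exact_mod_cast Fintype.card_pos
    have hc : 0 < 1 + T / (lam * Fintype.card n) := by positivity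
    have h := (hpd T le_rfl).log_det_le (mul_pos hlam0 hc)
      ((htrace T le_rfl).trans_eq (by field_simp))
    rw [Real.log_mul hlam0.ne' hc.ne'] at h
    linarith

/-- deterministic core of Theorem 2 of the paper (cumulative
regret on the confidence event, with corrected constants). Arms at each round
are indexed by a finite nonempty type `ι` with round-dependent features
`v t a`; the pulled arm `arm t` maximizes the relaxed UCB
`⟨v_a, θ̂_t⟩ + 2 α_t ‖v_a‖_{A_t⁻¹}`. Then
`Σ_{t=1}^T (max_a ⟨v_a, θ*⟩ - ⟨v_{a_t}, θ*⟩) ≤ 3 α_T √(2 T d log(1 + T/(λ d)))`. -/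
theorem cumulative_regret_bound
    (d : ℕ) (hd : 1 ≤ d) (lam : ℝ) (hlam : 1 ≤ lam) (T : ℕ) (hT : 1 ≤ T)
    (θstar : Fin d → ℝ)
    (α : ℕ → ℝ)
    (hα0 : ∀ t, 1 ≤ t → t ≤ T → 0 ≤ α t)
    (hαmono : ∀ s t, 1 ≤ s → s ≤ t → t ≤ T → α s ≤ α t)
    {ι : Type*} [Fintype ι] [Nonempty ι]
    (v : ℕ → ι → Fin d → ℝ)
    (hnorm : ∀ t, 1 ≤ t → t ≤ T → ∀ a, Real.sqrt (v t a ⬝ᵥ v t a) ≤ 1)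
    (arm : ℕ → ι)
    (A : ℕ → Matrix (Fin d) (Fin d) ℝ)
    (hA1 : A 1 = lam • (1 : Matrix (Fin d) (Fin d) ℝ))
    (hAs : ∀ t, 1 ≤ t → t ≤ T →
      A (t + 1) = A t + Matrix.vecMulVec (v t (arm t)) (v t (arm t)))
    (θhat : ℕ → Fin d → ℝ)
    (hconf : ∀ t, 1 ≤ t → t ≤ T → ∀ a,
      |v t a ⬝ᵥ θhat t - v t a ⬝ᵥ θstar|
        ≤ α t * Real.sqrt (v t a ⬝ᵥ ((A t)⁻¹).mulVec (v t a)))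
    (hpull : ∀ t, 1 ≤ t → t ≤ T → ∀ a,
      v t a ⬝ᵥ θhat t + 2 * α t * Real.sqrt (v t a ⬝ᵥ ((A t)⁻¹).mulVec (v t a))
        ≤ v t (arm t) ⬝ᵥ θhat t
          + 2 * α t * Real.sqrt (v t (arm t) ⬝ᵥ ((A t)⁻¹).mulVec (v t (arm t)))) :
    ∑ t ∈ Finset.Icc 1 T,
        (Finset.univ.sup' Finset.univ_nonempty (fun a => v t a ⬝ᵥ θstar)
          - v t (arm t) ⬝ᵥ θstar)
      ≤ 3 * α T * Real.sqrt (2 * T * d * Real.log (1 + (T : ℝ) / (lam * d))) := by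
  have : Nonempty (Fin d) := ⟨⟨0, hd⟩⟩
  set w : ℕ → ℝ := fun t => v t (arm t) ⬝ᵥ (A t)⁻¹ *ᵥ v t (arm t)
  obtain ⟨hw0, hpot⟩ := sum_dotProduct_inv_mulVec_le hlam T (fun t => v t (arm t)) A
    (fun t h1 ht => by simpa using Real.sqrt_le_iff.1 (hnorm t h1 ht (arm t))) hA1 hAs
  rw [Fintype.card_fin] at hpot
  have hround : ∀ t ∈ Finset.Icc 1 T,
      Finset.univ.sup' Finset.univ_nonempty (fun a => v t a ⬝ᵥ θstar) - v t (arm t) ⬝ᵥ θstar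
        ≤ 3 * α T * √(w t) := by
    intro t ht
    obtain ⟨h1, hT'⟩ := Finset.mem_Icc.1 ht
    rw [sub_le_iff_le_add]
    refine Finset.sup'_le _ _ fun a _ => ?_
    have ha := abs_le.1 (hconf t h1 hT' a)
    have hp := abs_le.1 (hconf t h1 hT' (arm t))
    have hα := mul_le_mul_of_nonneg_right (hαmono t T h1 hT' le_rfl) (Real.sqrt_nonneg (w t))
    have hwa := mul_nonneg (hα0 t h1 hT') (Real.sqrt_nonneg (v t a ⬝ᵥ (A t)⁻¹ *ᵥ v t a))
    linarith [hpull t h1 hT' a, ha.1, hp.2]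
  refine (Finset.sum_le_sum hround).trans ?_
  rw [← Finset.mul_sum]
  refine mul_le_mul_of_nonneg_left ?_ (by linarith [hα0 T hT le_rfl])
  refine Real.le_sqrt_of_sq_le (sq_sum_le_card_mul_sum_sq.trans ?_)
  rw [Finset.sum_congr rfl fun t ht => Real.sq_sqrt
    (hw0 t (Finset.mem_Icc.1 ht).1 (Finset.mem_Icc.1 ht).2), Nat.card_Icc, Nat.add_sub_cancel]
  exact (mul_le_mul_of_nonneg_left hpot T.cast_nonneg).trans_eq (by ring)
end
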